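/- One has the identity −2·#{s ∈ ℕ : s ∉ S and s ≥ δ} = −1 − (δ−1)(δ−2)/(pq) − (p² + q² − 3p − 3q − 2)/(6pq) − ⌈δ/p⌉ − ⌈δ/q⌉ + c + (1/2)·ε_{p,q}(δ−1) + 2·s(p, q; (δ−1)/q, 0) + 2·s(q, p; (δ−1)/p, 0). (Both sides equal the Ozsváth–Szabó d-invariant d(S³₁(T_{p,q})) of the +1-surgery on the torus knot T_{p,q}.) -/

import Mathlib

/-- The sawtooth function `((x))`: it is `0` for integers `x`, and `x - ⌊x⌋ - 1/2` otherwise. -/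
noncomputable def saw (x : ℝ) : ℝ := if Int.fract x = 0 then 0 else Int.fract x - 1/2

/-- The generalized Dedekind sum `s(a, b; x, y) = Σ_{i=0}^{b-1} (((i+y)/b))·((a(i+y)/b + x))`. -/
noncomputable def dsum (a b : ℤ) (x y : ℝ) : ℝ :=
  ∑ i ∈ Finset.range b.toNat,
    saw (((i : ℝ) + y) / (b : ℝ)) * saw ((a : ℝ) * ((i : ℝ) + y) / (b : ℝ) + x)

/-- The numerical semigroup generated by `p` and `q` (containing `0`). -/
def torusSemigroup (p q : ℕ) : Set ℕ := {s | ∃ a b : ℕ, s = a * p + b * q}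

theorem saw_nat (m q : ℕ) (hq : 0 < q) :
    saw ((m : ℝ) / q) = ((m % q : ℕ) : ℝ) / q - 1 / 2 + (if q ∣ m then (1 / 2 : ℝ) else 0) := by
  have hq' : (q : ℝ) ≠ 0 := by positivity
  unfold saw
  rw [Int.fract_div_natCast_eq_div_natCast_mod]
  by_cases h : q ∣ m
  · simp [h, Nat.mod_eq_zero_of_dvd h]
  · have h0 : m % q ≠ 0 := fun h' => h (Nat.dvd_of_mod_eq_zero h')
    have h1 : ((m % q : ℕ) : ℝ) / q ≠ 0 := div_ne_zero (by exact_mod_cast h0) hq'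
    rw [if_neg h1, if_neg h, add_zero]

theorem saw_small (i q : ℕ) (hi : i < q) :
    saw ((i : ℝ) / q) = (i : ℝ) / q - 1 / 2 + (if i = 0 then (1 / 2 : ℝ) else 0) := by
  rw [saw_nat i q (by omega), Nat.mod_eq_of_lt hi]
  have : (q ∣ i) ↔ i = 0 :=
    ⟨fun h => Nat.eq_zero_of_dvd_of_lt h hi, fun h => h ▸ dvd_zero q⟩
  simp only [this]

theorem saw_step (m q : ℕ) (hq : 0 < q) :
    saw (((m + 1 : ℕ) : ℝ) / q) = saw ((m : ℝ) / q) + 1 / q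
      - (1 / 2) * ((if q ∣ m + 1 then (1 : ℝ) else 0) + (if q ∣ m then (1 : ℝ) else 0)) := by
  have hq' : (q : ℝ) ≠ 0 := by positivity
  rw [saw_nat _ q hq, saw_nat _ q hq]
  have e1 : ((m % q : ℕ) : ℝ) = m - q * (m / q : ℕ) := by
    have := Nat.mod_add_div m q
    have h : ((m % q : ℕ) : ℝ) + q * (m / q : ℕ) = m := by exact_mod_cast this
    linarith
  have e2 : (((m + 1) % q : ℕ) : ℝ) = m + 1 - q * ((m + 1) / q : ℕ) := by
    have := Nat.mod_add_div (m + 1) q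
    have h : (((m + 1) % q : ℕ) : ℝ) + q * ((m + 1) / q : ℕ) = m + 1 := by exact_mod_cast this
    linarith
  rw [e1, e2, Nat.succ_div]
  split_ifs <;> push_cast <;> field_simp <;> ring

theorem sum_id_real (q : ℕ) : ∑ i ∈ Finset.range q, (i : ℝ) = q * (q - 1) / 2 := by
  induction q with
  | zero => simp
  | succ k ih => rw [Finset.sum_range_succ, ih]; push_cast; ring

theorem sum_sq_real (q : ℕ) :
    ∑ i ∈ Finset.range q, (i : ℝ) ^ 2 = q * (q - 1) * (2 * q - 1) / 6 := by
  induction q with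
  | zero => simp
  | succ k ih => rw [Finset.sum_range_succ, ih]; push_cast; ring

theorem sum_saw (q : ℕ) (hq : 0 < q) : ∑ i ∈ Finset.range q, saw ((i : ℝ) / q) = 0 := by
  have hq' : (q : ℝ) ≠ 0 := by positivity
  rw [Finset.sum_congr rfl (fun i hi => saw_small i q (Finset.mem_range.1 hi))]
  rw [Finset.sum_add_distrib, Finset.sum_sub_distrib, ← Finset.sum_div, sum_id_real]
  rw [Finset.sum_ite_eq' (Finset.range q) 0 (fun _ => (1 / 2 : ℝ))]
  simp [hq]
  field_simp
  ring

/-- Integer version of the Dedekind sum. -/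
noncomputable def DD (p q n : ℕ) : ℝ :=
  ∑ i ∈ Finset.range q, saw ((i : ℝ) / q) * saw (((p * i + n : ℕ) : ℝ) / q)

theorem dsum_eq (p q n : ℕ) :
    dsum (p : ℤ) (q : ℤ) ((n : ℝ) / q) 0 = DD p q n := by
  unfold dsum DD
  rw [Int.toNat_natCast]
  refine Finset.sum_congr rfl fun i _ => ?_
  push_cast
  rw [add_zero, add_div]

theorem sum_pick (p q n α : ℕ) (hcop : Nat.Coprime p q) (hα : α < q)
    (h : α * p ≡ n [MOD q]) :
    ∑ i ∈ Finset.range q, saw ((i : ℝ) / q) * (if q ∣ p * i + n then (1 : ℝ) else 0)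
      = -((α : ℝ) / q - 1 / 2 + (if q ∣ n then (1 / 2 : ℝ) else 0)) := by
  have hq : 0 < q := by omega
  have hq' : (q : ℝ) ≠ 0 := by positivity
  have key : ∀ i, q ∣ p * i + n ↔ q ∣ i + α := by
    intro i
    have h1 : p * (i + α) ≡ p * i + n [MOD q] := by
      rw [mul_add]
      exact Nat.ModEq.add_left _ (by rw [mul_comm p α]; exact h)
    rw [← h1.dvd_iff (dvd_refl q)]
    exact (Nat.Coprime.dvd_mul_left hcop.symm)
  have k0 : q ∣ n ↔ α = 0 := by
    have := key 0
    simp only [mul_zero, zero_add] at this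
    rw [this]
    exact ⟨fun h => Nat.eq_zero_of_dvd_of_lt h hα, fun h => h ▸ dvd_zero q⟩
  simp only [key, k0]
  rcases Nat.eq_zero_or_pos α with h0 | h0
  · subst h0
    rw [Finset.sum_eq_single_of_mem 0 (Finset.mem_range.2 hq)]
    · simp [saw]
    · intro i hi hne
      have : ¬ q ∣ i + 0 := fun h => hne (Nat.eq_zero_of_dvd_of_lt h (Finset.mem_range.1 hi))
      rw [if_neg this, mul_zero]
  · rw [Finset.sum_eq_single_of_mem (q - α) (Finset.mem_range.2 (by omega))]
    · have e : q - α + α = q := by omega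
      rw [e, if_pos (dvd_refl q), saw_small _ _ (by omega : q - α < q), if_neg (by omega),
        if_neg (by omega), Nat.cast_sub hα.le]
      field_simp
      ring
    · intro i hi hne
      have hi := Finset.mem_range.1 hi
      have : ¬ q ∣ i + α := by
        rintro ⟨k, hk⟩
        have : k < 2 := by
          by_contra hk2
          have : q * 2 ≤ q * k := Nat.mul_le_mul_left q (by omega)
          omega
        interval_cases k <;> omega
      rw [if_neg this, mul_zero]

theorem DD_step (p q n α α' : ℕ) (hcop : Nat.Coprime p q) (hα : α < q)
    (h : α * p ≡ n [MOD q]) (hα' : α' < q) (h' : α' * p ≡ n + 1 [MOD q]) :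
    2 * DD p q (n + 1) = 2 * DD p q n + ((α : ℝ) / q - 1 / 2 + (if q ∣ n then (1 / 2 : ℝ) else 0))
      + ((α' : ℝ) / q - 1 / 2 + (if q ∣ n + 1 then (1 / 2 : ℝ) else 0)) := by
  have hq : 0 < q := by omega
  have h1 := sum_pick p q n α hcop hα h
  have h2 := sum_pick p q (n + 1) α' hcop hα' h'
  have h3 := sum_saw q hq
  have : DD p q (n + 1) = DD p q n
      + (∑ i ∈ Finset.range q, saw ((i : ℝ) / q)) * (1 / q)
      - (1 / 2) * (∑ i ∈ Finset.range q,
          saw ((i : ℝ) / q) * (if q ∣ p * i + (n + 1) then (1 : ℝ) else 0))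
      - (1 / 2) * (∑ i ∈ Finset.range q,
          saw ((i : ℝ) / q) * (if q ∣ p * i + n then (1 : ℝ) else 0)) := by
    unfold DD
    rw [Finset.sum_mul, Finset.mul_sum, Finset.mul_sum, ← Finset.sum_add_distrib,
      ← Finset.sum_sub_distrib, ← Finset.sum_sub_distrib]
    refine Finset.sum_congr rfl fun i _ => ?_
    rw [← add_assoc, saw_step _ q hq]
    ring
  rw [this, h1, h2, h3]
  ring

theorem exists_alpha (p q n : ℕ) (hcop : Nat.Coprime p q) (hq : 0 < q) :
    ∃ α < q, α * p ≡ n [MOD q] := by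
  obtain ⟨x, hx⟩ := Nat.exists_mul_mod_eq_of_coprime n hcop hq.ne'
  refine ⟨x % q, Nat.mod_lt _ hq, ?_⟩
  have : x % q * p ≡ x * p [MOD q] := (Nat.mod_modEq x q).mul_right p
  refine this.trans ?_
  rw [mul_comm]
  exact hx.2

theorem mem_iff (p q n α : ℕ) (hcop : Nat.Coprime p q) (hα : α < q)
    (h : α * p ≡ n [MOD q]) : n ∈ torusSemigroup p q ↔ α * p ≤ n := by
  constructor
  · rintro ⟨a, b, hab⟩
    have h1 : α * p ≡ a * p [MOD q] := by
      refine h.trans ?_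
      rw [hab]
      simp [Nat.ModEq]
    have h2 : α ≡ a [MOD q] := Nat.ModEq.cancel_right_of_coprime hcop.symm h1
    have h3 : α ≤ a := by
      have : α % q = a % q := h2
      rw [Nat.mod_eq_of_lt hα] at this
      rw [this]; exact Nat.mod_le _ _
    have := Nat.mul_le_mul_right p h3
    omega
  · intro hle
    obtain ⟨k, hk⟩ := (Nat.modEq_iff_dvd' hle).1 h
    exact ⟨α, k, by rw [mul_comm k q]; omega⟩

open Classical in
theorem popoviciu (p q n α β : ℕ) (hcop : Nat.Coprime p q) (hα : α < q)
    (h : α * p ≡ n [MOD q]) (hβ : β < p) (h' : β * q ≡ n [MOD p]) (hn : n < p * q) :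
    (α : ℝ) / q + (β : ℝ) / p = 1 + (n : ℝ) / (p * q)
      - (if n ∈ torusSemigroup p q then (1 : ℝ) else 0) := by
  have hq' : (q : ℝ) ≠ 0 := by have : 0 < q := by omega
                               positivity
  have hp' : (p : ℝ) ≠ 0 := by have : 0 < p := by omega
                               positivity
  have hm := mem_iff p q n α hcop hα h
  by_cases hle : α * p ≤ n
  · rw [if_pos (hm.2 hle)]
    obtain ⟨k, hk⟩ := (Nat.modEq_iff_dvd' hle).1 h
    have hn' : n = α * p + q * k := by omega
    have hk' : k < p := by
      have : q * k < q * p := by rw [mul_comm q p]; omega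
      exact Nat.lt_of_mul_lt_mul_left this
    have h1 : β * q ≡ k * q [MOD p] := by
      refine h'.trans ?_
      rw [hn', mul_comm q k]; simp [Nat.ModEq]
    have h2 : β = k :=
      (Nat.ModEq.cancel_right_of_coprime hcop h1).eq_of_lt_of_lt hβ hk'
    rw [hn', h2]; push_cast; field_simp; ring
  · rw [if_neg (fun h => hle (hm.1 h))]
    push Not at hle
    obtain ⟨k, hk⟩ := (Nat.modEq_iff_dvd' hle.le).1 h.symm
    have hn' : n + q * k = α * p := by omega
    have hk0 : 0 < k := by
      rcases Nat.eq_zero_or_pos k with h0 | h0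
      · subst h0; omega
      · exact h0
    have hk' : k < p := by
      have h1 : q * k < q * p := by
        have : α * p < q * p := Nat.mul_lt_mul_of_pos_right hα (by omega)
        omega
      exact Nat.lt_of_mul_lt_mul_left h1
    have h1 : (β + k) * q ≡ 0 [MOD p] := by
      have : β * q + k * q ≡ n + k * q [MOD p] := h'.add_right _
      rw [add_mul]
      refine this.trans ?_
      rw [mul_comm k q, hn']
      simp [Nat.ModEq]
    have h2 : p ∣ β + k :=
      (Nat.Coprime.dvd_mul_right hcop).1 ((Nat.modEq_zero_iff_dvd).1 h1)
    have h3 : β + k = p := by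
      obtain ⟨t, ht⟩ := h2
      have : t < 2 := by
        by_contra hk2
        have : p * 2 ≤ p * t := Nat.mul_le_mul_left p (by omega)
        omega
      interval_cases t <;> omega
    have r1 : (n : ℝ) + q * k = α * p := by exact_mod_cast hn'
    have r2 : (β : ℝ) + k = p := by exact_mod_cast h3
    have r3 : (β : ℝ) = p - k := by linarith
    have r4 : (n : ℝ) = α * p - q * k := by linarith
    rw [r3, r4]; field_simp; ring

/-! Reciprocity -/

theorem residue_bij (p q : ℕ) (hp : 0 < p) (hq : 0 < q) (hcop : Nat.Coprime p q) (f : ℕ → ℝ) :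
    ∑ a ∈ Finset.range q, ∑ b ∈ Finset.range p, f ((a * p + b * q) % (p * q))
      = ∑ n ∈ Finset.range (p * q), f n := by
  rw [← Finset.sum_product']
  have hinj : Set.InjOn (fun x : ℕ × ℕ => (x.1 * p + x.2 * q) % (p * q))
      (Finset.range q ×ˢ Finset.range p : Finset (ℕ × ℕ)) := by
    rintro ⟨a, b⟩ hab ⟨c, d⟩ hcd heq
    simp only [Finset.coe_product, Finset.coe_range, Set.mem_prod, Set.mem_Iio] at hab hcd
    have heq : a * p + b * q ≡ c * p + d * q [MOD p * q] := heq
    have h1 : a * p ≡ c * p [MOD q] := by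
      have := heq.of_mul_left p
      simpa [Nat.ModEq] using this
    have h2 : b * q ≡ d * q [MOD p] := by
      have := heq.of_mul_right q
      simpa [Nat.ModEq] using this
    have h3 := (Nat.ModEq.cancel_right_of_coprime hcop.symm h1).eq_of_lt_of_lt hab.1 hcd.1
    have h4 := (Nat.ModEq.cancel_right_of_coprime hcop h2).eq_of_lt_of_lt hab.2 hcd.2
    rw [h3, h4]
  have himg : (Finset.range q ×ˢ Finset.range p).image
      (fun x : ℕ × ℕ => (x.1 * p + x.2 * q) % (p * q)) = Finset.range (p * q) := by
    apply Finset.eq_of_subset_of_card_le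
    · intro n hn
      obtain ⟨x, _, rfl⟩ := Finset.mem_image.1 hn
      exact Finset.mem_range.2 (Nat.mod_lt _ (by positivity))
    · rw [Finset.card_image_of_injOn hinj]
      simp [mul_comm]
  rw [← himg, Finset.sum_image hinj]

/-- carry indicator -/
noncomputable def ee (p q a b : ℕ) : ℝ := if p * q ≤ a * p + b * q then 1 else 0

theorem res_eq (p q a b : ℕ) (ha : a < q) (hb : b < p) :
    (((a * p + b * q) % (p * q) : ℕ) : ℝ) = a * p + b * q - p * q * ee p q a b := by
  have h1 : a * p < p * q := by
    rw [mul_comm p q]; exact Nat.mul_lt_mul_of_pos_right ha (by omega)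
  have h2 : b * q < p * q := Nat.mul_lt_mul_of_pos_right hb (by omega)
  unfold ee
  split_ifs with h
  · rw [Nat.mod_eq_sub_mod h, Nat.mod_eq_of_lt (by omega), Nat.cast_sub h]
    push_cast; ring
  · rw [Nat.mod_eq_of_lt (by omega)]
    push_cast; ring

theorem sum_ee (p q a : ℕ) (hp : 0 < p) (ha : a < q) :
    ∑ b ∈ Finset.range p, ee p q a b = ((p * a / q : ℕ) : ℝ) := by
  have hq : 0 < q := by omega
  have hlt : p * a / q < p := by
    rw [Nat.div_lt_iff_lt_mul hq]; exact Nat.mul_lt_mul_of_pos_left ha hp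
  unfold ee
  rw [Finset.sum_boole]
  have : (Finset.range p).filter (fun b => p * q ≤ a * p + b * q)
      = Finset.Ico (p - p * a / q) p := by
    ext b
    simp only [Finset.mem_filter, Finset.mem_range, Finset.mem_Ico]
    rw [and_comm]
    refine and_congr_left fun hb => ?_
    have h1 : p - p * a / q ≤ b ↔ p - b ≤ p * a / q := by omega
    rw [h1, Nat.le_div_iff_mul_le hq, Nat.sub_mul, mul_comm p a]
    omega
  have hsub : p - (p - p * a / q) = p * a / q := Nat.sub_sub_self hlt.le
  rw [this, Nat.card_Ico, hsub]

theorem ee_symm (p q a b : ℕ) : ee p q a b = ee q p b a := by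
  unfold ee
  rw [mul_comm q p, add_comm (b * q)]

theorem DD_zero (p q : ℕ) (hq : 0 < q) (hcop : Nat.Coprime p q) :
    DD p q 0 = ∑ i ∈ Finset.range q,
      ((i : ℝ) / q - 1 / 2) * ((p : ℝ) * i / q - (p * i / q : ℕ) - 1 / 2) - 1 / 4 := by
  have hq' : (q : ℝ) ≠ 0 := by positivity
  have : ∀ i ∈ Finset.range q, saw ((i : ℝ) / q) * saw (((p * i + 0 : ℕ) : ℝ) / q)
      = ((i : ℝ) / q - 1 / 2) * ((p : ℝ) * i / q - (p * i / q : ℕ) - 1 / 2)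
        - (if i = 0 then (1 / 4 : ℝ) else 0) := by
    intro i hi
    have hi := Finset.mem_range.1 hi
    rcases Nat.eq_zero_or_pos i with h0 | h0
    · subst h0; simp [saw]; norm_num
    · have hnd : ¬ q ∣ p * i + 0 := by
        rw [add_zero, Nat.Coprime.dvd_mul_left hcop.symm]
        exact Nat.not_dvd_of_pos_of_lt h0 hi
      rw [saw_small i q hi, saw_nat _ q hq, if_neg h0.ne', if_neg hnd, if_neg h0.ne']
      have e1 : (((p * i + 0) % q : ℕ) : ℝ) = p * i - q * (p * i / q : ℕ) := by
        have := Nat.mod_add_div (p * i) q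
        have h : ((p * i % q : ℕ) : ℝ) + q * (p * i / q : ℕ) = p * i := by exact_mod_cast this
        rw [add_zero]
        linarith
      rw [e1]
      field_simp
      ring
  unfold DD
  rw [Finset.sum_congr rfl this, Finset.sum_sub_distrib,
    Finset.sum_ite_eq' (Finset.range q) 0 (fun _ => (1 / 4 : ℝ))]
  simp [hq]

theorem DD_zero' (p q : ℕ) (hq : 0 < q) (hcop : Nat.Coprime p q) :
    q * DD p q 0 = p * (q - 1) * (2 * q - 1) / 6
      - ∑ i ∈ Finset.range q, (i : ℝ) * (p * i / q : ℕ) - q * (q - 1) / 4 - p * q * (q - 1) / 4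
      + (q / 2) * ∑ i ∈ Finset.range q, ((p * i / q : ℕ) : ℝ) + q * q / 4 - q / 4 := by
  have hq' : (q : ℝ) ≠ 0 := by positivity
  have : ∑ i ∈ Finset.range q,
      ((i : ℝ) / q - 1 / 2) * ((p : ℝ) * i / q - (p * i / q : ℕ) - 1 / 2)
      = (p / (q * q)) * ∑ i ∈ Finset.range q, (i : ℝ) ^ 2
        - (1 / q) * ∑ i ∈ Finset.range q, (i : ℝ) * (p * i / q : ℕ)
        - (1 / (2 * q) + p / (2 * q)) * ∑ i ∈ Finset.range q, (i : ℝ)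
        + (1 / 2) * ∑ i ∈ Finset.range q, ((p * i / q : ℕ) : ℝ)
        + ∑ i ∈ Finset.range q, (1 / 4 : ℝ) := by
    simp only [Finset.mul_sum]
    rw [← Finset.sum_sub_distrib, ← Finset.sum_sub_distrib, ← Finset.sum_add_distrib,
      ← Finset.sum_add_distrib]
    refine Finset.sum_congr rfl fun i _ => ?_
    field_simp
    ring
  rw [DD_zero p q hq hcop, this, sum_id_real, sum_sq_real]
  simp only [Finset.sum_const, Finset.card_range, nsmul_eq_mul]
  field_simp
  ring

theorem first_moment (p q : ℕ) (hp : 0 < p) (hq : 0 < q) (hcop : Nat.Coprime p q) :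
    ∑ i ∈ Finset.range q, ((p * i / q : ℕ) : ℝ) = ((p : ℝ) - 1) * (q - 1) / 2 := by
  have hq' : (q : ℝ) ≠ 0 := by positivity
  have hp' : (p : ℝ) ≠ 0 := by positivity
  have h := residue_bij p q hp hq hcop (fun n => (n : ℝ))
  rw [sum_id_real] at h
  have h2 : ∑ a ∈ Finset.range q, ∑ b ∈ Finset.range p, (((a * p + b * q) % (p * q) : ℕ) : ℝ)
      = p * (p * ∑ a ∈ Finset.range q, (a : ℝ)) + q * (q * ∑ b ∈ Finset.range p, (b : ℝ))
        - p * q * ∑ i ∈ Finset.range q, ((p * i / q : ℕ) : ℝ) := by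
    have : ∀ a ∈ Finset.range q,
        ∑ b ∈ Finset.range p, (((a * p + b * q) % (p * q) : ℕ) : ℝ)
        = p * (p * (a : ℝ)) + q * (∑ b ∈ Finset.range p, (b : ℝ))
          - p * q * ((p * a / q : ℕ) : ℝ) := by
      intro a ha
      have ha := Finset.mem_range.1 ha
      rw [Finset.sum_congr rfl (fun b hb => res_eq p q a b ha (Finset.mem_range.1 hb)),
        Finset.sum_sub_distrib, Finset.sum_add_distrib,
        ← Finset.mul_sum (Finset.range p) (fun b => ee p q a b), sum_ee p q a hp ha,
        ← Finset.sum_mul (Finset.range p) (fun b => (b : ℝ))]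
      simp only [Finset.sum_const, Finset.card_range, nsmul_eq_mul]
      ring
    rw [Finset.sum_congr rfl this, Finset.sum_sub_distrib, Finset.sum_add_distrib]
    simp only [← Finset.mul_sum, Finset.sum_const, Finset.card_range, nsmul_eq_mul]
    try ring
  rw [h2, sum_id_real, sum_id_real] at h
  push_cast at h
  have h3 : ((p : ℝ) * q) * (∑ i ∈ Finset.range q, ((p * i / q : ℕ) : ℝ))
      = (p * q) * (((p : ℝ) - 1) * (q - 1) / 2) := by linarith
  exact mul_left_cancel₀ (mul_ne_zero hp' hq') h3

theorem second_moment (p q : ℕ) (hp : 0 < p) (hq : 0 < q) (hcop : Nat.Coprime p q) :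
    2 * p * q * (p * ∑ i ∈ Finset.range q, (i : ℝ) * (p * i / q : ℕ)
        + q * ∑ i ∈ Finset.range p, (i : ℝ) * (q * i / p : ℕ))
      = p * p * p * (q * (q - 1) * (2 * q - 1) / 6) + q * q * q * (p * (p - 1) * (2 * p - 1) / 6)
        + 2 * p * q * (q * (q - 1) / 2) * (p * (p - 1) / 2)
        + p * q * (p * q) * (((p : ℝ) - 1) * (q - 1) / 2)
        - p * q * (p * q - 1) * (2 * (p * q) - 1) / 6 := by
  have h := residue_bij p q hp hq hcop (fun n => (n : ℝ) ^ 2)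
  rw [sum_sq_real] at h
  have hexp : ∑ a ∈ Finset.range q, ∑ b ∈ Finset.range p,
        (((a * p + b * q) % (p * q) : ℕ) : ℝ) ^ 2
      = ∑ a ∈ Finset.range q, ∑ b ∈ Finset.range p,
        ((p * p * (a : ℝ) ^ 2 + q * q * (b : ℝ) ^ 2 + 2 * p * q * ((a : ℝ) * b)
          + p * q * (p * q) * ee p q a b) - 2 * p * q * (p * (a * ee p q a b))
          - 2 * p * q * (q * (b * ee p q a b))) := by
    refine Finset.sum_congr rfl fun a ha => Finset.sum_congr rfl fun b hb => ?_
    rw [res_eq p q a b (Finset.mem_range.1 ha) (Finset.mem_range.1 hb)]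
    have : ee p q a b * ee p q a b = ee p q a b := by
      unfold ee; split_ifs <;> simp
    linear_combination (p * q * (p * q) : ℝ) * this
  have hA : ∑ a ∈ Finset.range q, ∑ b ∈ Finset.range p, (a : ℝ) * ee p q a b
      = ∑ i ∈ Finset.range q, (i : ℝ) * (p * i / q : ℕ) := by
    refine Finset.sum_congr rfl fun a ha => ?_
    rw [← Finset.mul_sum, sum_ee p q a hp (Finset.mem_range.1 ha)]
  have hB : ∑ a ∈ Finset.range q, ∑ b ∈ Finset.range p, (b : ℝ) * ee p q a b
      = ∑ i ∈ Finset.range p, (i : ℝ) * (q * i / p : ℕ) := by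
    rw [Finset.sum_comm]
    refine Finset.sum_congr rfl fun b hb => ?_
    simp only [ee_symm p q]
    rw [← Finset.mul_sum, sum_ee q p b hq (Finset.mem_range.1 hb)]
  have hE : ∑ a ∈ Finset.range q, ∑ b ∈ Finset.range p, ee p q a b
      = ((p : ℝ) - 1) * (q - 1) / 2 := by
    rw [← first_moment p q hp hq hcop]
    exact Finset.sum_congr rfl fun a ha => sum_ee p q a hp (Finset.mem_range.1 ha)
  rw [hexp] at h
  simp only [Finset.sum_sub_distrib, Finset.sum_add_distrib, ← Finset.mul_sum] at h
  simp only [← Finset.mul_sum] at hA hB hE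
  rw [hA, hB, hE, ← Finset.sum_mul] at h
  simp only [Finset.sum_const, Finset.card_range, nsmul_eq_mul, sum_sq_real, sum_id_real,
    ← Finset.mul_sum] at h
  push_cast at h
  linarith

theorem reciprocity (p q : ℕ) (hp : 0 < p) (hq : 0 < q) (hcop : Nat.Coprime p q) :
    2 * DD p q 0 + 2 * DD q p 0 = -1 / 2 + ((p : ℝ) ^ 2 + q ^ 2 + 1) / (6 * p * q) := by
  have hq' : (q : ℝ) ≠ 0 := by positivity
  have hp' : (p : ℝ) ≠ 0 := by positivity
  have h1 := DD_zero' p q hq hcop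
  have h2 := DD_zero' q p hp hcop.symm
  have h3 := second_moment p q hp hq hcop
  rw [first_moment p q hp hq hcop] at h1
  rw [first_moment q p hq hp hcop.symm] at h2
  have h4 : (p * q * (p * q) : ℝ) * (2 * DD p q 0 + 2 * DD q p 0)
      = (p * q * (p * q) : ℝ) * (-1 / 2 + ((p : ℝ) ^ 2 + q ^ 2 + 1) / (6 * p * q)) := by
    have : (p * q * (p * q) : ℝ) * (-1 / 2 + ((p : ℝ) ^ 2 + q ^ 2 + 1) / (6 * p * q))
      = - (p * q * (p * q)) / 2 + p * q * ((p : ℝ) ^ 2 + q ^ 2 + 1) / 6 := by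
      field_simp
    rw [this]
    linear_combination (2 * p * p * q : ℝ) * h1 + (2 * p * q * q : ℝ) * h2 - h3
  exact mul_left_cancel₀ (by positivity) h4

open Classical in
theorem count_formula (p q : ℕ) (hp : 0 < p) (hq : 0 < q) (hcop : Nat.Coprime p q) (n : ℕ)
    (hn : n < p * q) :
    -2 * (∑ s ∈ Finset.range (n + 1), (if s ∈ torusSemigroup p q then (1 : ℝ) else 0)) =
      -1 / 2 - (n : ℝ) ^ 2 / (p * q) - ((p : ℝ) ^ 2 + q ^ 2 + 1) / (6 * p * q)
        - (n / p : ℕ) - (n / q : ℕ) - 2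
        + (1 - (if n ∈ torusSemigroup p q then (1 : ℝ) else 0))
        + (1 / 2) * ((if p ∣ n then (1 : ℝ) else 0) + (if q ∣ n then (1 : ℝ) else 0))
        + 2 * DD p q n + 2 * DD q p n := by
  have hq' : (q : ℝ) ≠ 0 := by positivity
  have hp' : (p : ℝ) ≠ 0 := by positivity
  induction n with
  | zero =>
    have h0 : (0 : ℕ) ∈ torusSemigroup p q := ⟨0, 0, by simp⟩
    have := reciprocity p q hp hq hcop
    rw [Finset.sum_range_one, if_pos h0]
    simp
    linarith
  | succ n ih =>
    have ih := ih (by omega)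
    obtain ⟨α, hα, h1⟩ := exists_alpha p q n hcop hq
    obtain ⟨α', hα', h1'⟩ := exists_alpha p q (n + 1) hcop hq
    obtain ⟨β, hβ, h2⟩ := exists_alpha q p n hcop.symm hp
    obtain ⟨β', hβ', h2'⟩ := exists_alpha q p (n + 1) hcop.symm hp
    have e1 := DD_step p q n α α' hcop hα h1 hα' h1'
    have e2 := DD_step q p n β β' hcop.symm hβ h2 hβ' h2'
    have e3 := popoviciu p q n α β hcop hα h1 hβ h2 (by omega)
    have e4 := popoviciu p q (n + 1) α' β' hcop hα' h1' hβ' h2' hn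
    have half : ∀ (P : Prop) [Decidable P], (if P then (1 / 2 : ℝ) else 0) = (1 / 2) * (if P then 1 else 0) := by
      intro P _; split_ifs <;> simp
    rw [Finset.sum_range_succ, mul_add, ih, Nat.succ_div, Nat.succ_div]
    simp only [half] at e1 e2
    push_cast at e4 ⊢
    have e5 : ((n : ℝ) + 1) ^ 2 / (p * q) = (n : ℝ) ^ 2 / (p * q) + n / (p * q)
      + (n + 1) / (p * q) := by ring
    rw [e5]
    linarith

theorem frob (p q : ℕ) (hp : 0 < p) (hq : 0 < q) (hcop : Nat.Coprime p q) (s : ℕ)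
    (h : s ∉ torusSemigroup p q) :
    ∃ t ∈ torusSemigroup p q, s + t + p + q = p * q := by
  obtain ⟨α, hα, h1⟩ := exists_alpha p q s hcop hq
  rw [mem_iff p q s α hcop hα h1] at h
  push Not at h
  obtain ⟨k, hk⟩ := (Nat.modEq_iff_dvd' h.le).1 h1.symm
  have hk0 : 0 < k := by
    rcases Nat.eq_zero_or_pos k with h0 | h0
    · subst h0; omega
    · exact h0
  refine ⟨(q - 1 - α) * p + (k - 1) * q, ⟨_, _, rfl⟩, ?_⟩
  obtain ⟨j, rfl⟩ := Nat.exists_eq_add_of_lt hα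
  obtain ⟨l, rfl⟩ := Nat.exists_eq_add_of_lt hk0
  have e : α + j + 1 - 1 - α = j := by omega
  have e' : 0 + l + 1 - 1 = l := by omega
  rw [e, e']
  have hk2 : α * p = s + (α + j + 1) * (0 + l + 1) := by omega
  nlinarith

theorem frob_not (p q : ℕ) (hp : 0 < p) (hq : 0 < q) (hcop : Nat.Coprime p q) (s t : ℕ)
    (hs : s ∈ torusSemigroup p q) (ht : t ∈ torusSemigroup p q) : s + t + p + q ≠ p * q := by
  obtain ⟨a, b, rfl⟩ := hs
  obtain ⟨c, d, rfl⟩ := ht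
  intro h
  have h' : (a + c + 1) * p + (b + d + 1) * q = p * q := by rw [← h]; ring
  have h1 : q ∣ (a + c + 1) * p := by
    refine (Nat.dvd_add_left (dvd_mul_left q (b + d + 1))).1 ?_
    rw [h']; exact dvd_mul_left q p
  have h2 : q ≤ a + c + 1 :=
    Nat.le_of_dvd (by omega) ((Nat.Coprime.dvd_mul_right hcop.symm).1 h1)
  have h3 := Nat.mul_le_mul_right p h2
  have h4 : 0 < (b + d + 1) * q := by positivity
  rw [mul_comm p q] at h'
  omega

open Classical in
theorem ncard_eq (p q : ℕ) (hp : 0 < p) (hq : 0 < q) (hcop : Nat.Coprime p q) (n : ℕ)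
    (h : 2 * n + 1 + p + q = p * q) :
    (Set.ncard {s : ℕ | s ∉ torusSemigroup p q ∧ n + 1 ≤ s} : ℝ)
      = ∑ s ∈ Finset.range (n + 1), (if s ∈ torusSemigroup p q then (1 : ℝ) else 0) := by
  rw [Finset.sum_boole]
  have : {s : ℕ | s ∉ torusSemigroup p q ∧ n + 1 ≤ s}
      = (((Finset.range (n + 1)).filter (fun s => s ∈ torusSemigroup p q)).image
        (fun s => 2 * n + 1 - s) : Finset ℕ) := by
    ext s
    simp only [Set.mem_ofPred_eq, Finset.coe_image, Finset.coe_filter, Finset.mem_range,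
      Set.mem_image]
    constructor
    · rintro ⟨hs, hle⟩
      obtain ⟨t, ht, hst⟩ := frob p q hp hq hcop s hs
      exact ⟨t, ⟨by omega, ht⟩, by omega⟩
    · rintro ⟨t, ⟨htn, ht⟩, rfl⟩
      refine ⟨fun hs => frob_not p q hp hq hcop _ _ hs ht (by omega), by omega⟩
  rw [this, Set.ncard_coe_finset, Finset.card_image_of_injOn]
  intro a ha b hb hab
  simp only [Finset.coe_filter, Finset.mem_range, Set.mem_ofPred_eq] at ha hb hab
  omega

open Classical in
/-- the `d`-invariant `d(S³₁(T_{p,q})) = −2·#{s ∉ S : s ≥ δ}` is given by the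
closed formula `−1 − (δ−1)(δ−2)/(pq) − (p²+q²−3p−3q−2)/(6pq) − ⌈δ/p⌉ − ⌈δ/q⌉ + c
  + ε_{p,q}(δ−1)/2 + 2s(p,q;(δ−1)/q,0) + 2s(q,p;(δ−1)/p,0)`. -/
theorem d_invariant_formula (p q : ℕ) (hp : 2 ≤ p) (hpq : p < q) (hcop : Nat.Coprime p q)
    (δ : ℕ) (hδ : 2 * δ = (p - 1) * (q - 1)) :
    -2 * (Set.ncard {s : ℕ | s ∉ torusSemigroup p q ∧ δ ≤ s} : ℝ) =
      -1 - ((δ : ℝ) - 1) * ((δ : ℝ) - 2) / ((p : ℝ) * (q : ℝ))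
        - ((p : ℝ) ^ 2 + (q : ℝ) ^ 2 - 3 * (p : ℝ) - 3 * (q : ℝ) - 2) / (6 * (p : ℝ) * (q : ℝ))
        - (⌈(δ : ℝ) / (p : ℝ)⌉ : ℝ) - (⌈(δ : ℝ) / (q : ℝ)⌉ : ℝ)
        + (if δ - 1 ∈ torusSemigroup p q then (0 : ℝ) else 1)
        + (1 / 2) * ((if p ∣ δ - 1 then (1 : ℝ) else 0) + (if q ∣ δ - 1 then (1 : ℝ) else 0))
        + 2 * dsum (p : ℤ) (q : ℤ) (((δ : ℝ) - 1) / (q : ℝ)) 0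
        + 2 * dsum (q : ℤ) (p : ℤ) (((δ : ℝ) - 1) / (p : ℝ)) 0 := by
  have hp0 : 0 < p := by omega
  have hq0 : 0 < q := by omega
  have hq' : (q : ℝ) ≠ 0 := by positivity
  have hp' : (p : ℝ) ≠ 0 := by positivity
  have hδ' : 2 * δ + p + q = p * q + 1 := by
    obtain ⟨a, rfl⟩ := Nat.exists_eq_add_of_lt hp0
    obtain ⟨b, rfl⟩ := Nat.exists_eq_add_of_lt hq0
    have e1 : 0 + a + 1 - 1 = a := by omega
    have e2 : 0 + b + 1 - 1 = b := by omega
    rw [e1, e2] at hδ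
    rw [hδ]; ring
  have hpos : 0 < δ := by
    have : 0 < (p - 1) * (q - 1) := Nat.mul_pos (by omega) (by omega)
    omega
  obtain ⟨n, rfl⟩ : ∃ n, δ = n + 1 := ⟨δ - 1, by omega⟩
  have hn : 2 * n + 1 + p + q = p * q := by omega
  have ce : ∀ r : ℕ, 0 < r → ((⌈((n + 1 : ℕ) : ℝ) / (r : ℝ)⌉ : ℤ) : ℝ) = (n / r : ℕ) + 1 := by
    intro r hr
    have hr' : (0 : ℝ) < r := by positivity
    have : ⌈((n + 1 : ℕ) : ℝ) / (r : ℝ)⌉ = ((n / r : ℕ) : ℤ) + 1 := by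
      have h1 := Nat.div_add_mod n r
      have h2 := Nat.mod_lt n hr
      have h1' : (r : ℝ) * (n / r : ℕ) + (n % r : ℕ) = n := by exact_mod_cast h1
      have h2' : ((n % r : ℕ) : ℝ) + 1 ≤ r := by exact_mod_cast h2
      have h3' : (0 : ℝ) ≤ (n % r : ℕ) := by positivity
      generalize n / r = t at *
      rw [Int.ceil_eq_iff]
      constructor
      · rw [lt_div_iff₀ hr']; push_cast; nlinarith
      · rw [div_le_iff₀ hr']; push_cast; nlinarith
    rw [this, Int.cast_add, Int.cast_natCast, Int.cast_one]
  have hc := count_formula p q hp0 hq0 hcop n (by omega)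
  have e0 : ((n + 1 : ℕ) : ℝ) - 1 = n := by push_cast; ring
  have hif : (if n ∈ torusSemigroup p q then (0 : ℝ) else 1)
      = 1 - (if n ∈ torusSemigroup p q then (1 : ℝ) else 0) := by split_ifs <;> simp
  rw [ncard_eq p q hp0 hq0 hcop n hn, hc, ce p hp0, ce q hq0, e0, dsum_eq, dsum_eq,
    Nat.add_sub_cancel, hif]
  have hnr : (2 * n + 1 + p + q : ℝ) = p * q := by exact_mod_cast hn
  have key : -1 / 2 - (n : ℝ) ^ 2 / (p * q) - ((p : ℝ) ^ 2 + q ^ 2 + 1) / (6 * p * q)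
      = -1 - (n : ℝ) * (((n + 1 : ℕ) : ℝ) - 2) / ((p : ℝ) * (q : ℝ))
        - ((p : ℝ) ^ 2 + (q : ℝ) ^ 2 - 3 * (p : ℝ) - 3 * (q : ℝ) - 2)
          / (6 * (p : ℝ) * (q : ℝ)) := by
    push_cast
    field_simp
    linear_combination (-6 : ℝ) * hnr
  linear_combination key
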